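/- The 3(g−1) quadratic monomials B⁺ = {x_0x_i : 0 ≤ i ≤ 2k} ∪ {x_kx_i : 1 ≤ i ≤ 2k−1} ∪ {x_{2k}x_i : 1 ≤ i ≤ 2k}, regarded as elements of A, form a basis of V₂. -/

import Mathlib

set_option synthInstance.maxHeartbeats 400000
set_option maxHeartbeats 1000000

noncomputable section

open scoped TensorProduct

/-- The coordinate ring `A = ℂ[u,ε]/(ε²)` of the chart `U` of the balanced ribbon. -/
def A : Type := DualNumber (Polynomial ℂ)

instance : CommRing A := inferInstanceAs (CommRing (DualNumber (Polynomial ℂ)))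
instance : Algebra ℂ A := inferInstanceAs (Algebra ℂ (DualNumber (Polynomial ℂ)))

def uu : A := TrivSqZeroExt.inl Polynomial.X
def ee : A := DualNumber.eps

/-- The restrictions to `U` of the standard basis of `H⁰(ω)` of the balanced ribbon. -/
def x (k i : ℕ) : A :=
  if i ≤ k then uu ^ i else uu ^ i + ((i - k : ℕ) : A) * uu ^ (i - k - 1) * ee

/-- `V_m`: the span of the degree-`m` monomials in `x_0, …, x_{2k}`. -/
def V (k m : ℕ) : Submodule ℂ A :=
  Submodule.span ℂ {a | ∃ f : Fin m → ℕ, (∀ j, f j ≤ 2 * k) ∧ a = ∏ j, x k (f j)}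

/-- The family of `3(g−1) = 6k` quadratic monomials
`B⁺ = {x_0 x_i}_{0 ≤ i ≤ 2k} ∪ {x_k x_i}_{1 ≤ i ≤ 2k−1} ∪ {x_{2k} x_i}_{1 ≤ i ≤ 2k}`. -/
def Bplus (k : ℕ) : Fin (2 * k + 1) ⊕ (Fin (2 * k - 1) ⊕ Fin (2 * k)) → A
  | Sum.inl i => x k 0 * x k (i : ℕ)
  | Sum.inr (Sum.inl i) => x k k * x k ((i : ℕ) + 1)
  | Sum.inr (Sum.inr i) => x k (2 * k) * x k ((i : ℕ) + 1)

/-- The `1`-component of an element of `A`, as a linear map to polynomials. -/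
def fstA : A →ₗ[ℂ] Polynomial ℂ where
  toFun a := TrivSqZeroExt.fst (R := Polynomial ℂ) (M := Polynomial ℂ) a
  map_add' _ _ := rfl
  map_smul' _ _ := rfl

/-- The `ε`-component of an element of `A`, as a linear map to polynomials. -/
def sndA : A →ₗ[ℂ] Polynomial ℂ where
  toFun a := TrivSqZeroExt.snd (R := Polynomial ℂ) (M := Polynomial ℂ) a
  map_add' _ _ := rfl
  map_smul' _ _ := rfl

lemma uu_pow (n : ℕ) : uu ^ n =
    (TrivSqZeroExt.inl (Polynomial.X ^ n) : DualNumber (Polynomial ℂ)) :=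
  TrivSqZeroExt.inl_pow (M := Polynomial ℂ) (Polynomial.X : Polynomial ℂ) n

lemma uu_pow_mul_ee (n : ℕ) : uu ^ n * ee =
    (TrivSqZeroExt.inr (Polynomial.X ^ n) : DualNumber (Polynomial ℂ)) := by
  rw [uu_pow]
  refine (TrivSqZeroExt.inl_mul_inr (Polynomial.X ^ n : Polynomial ℂ)
    (1 : Polynomial ℂ)).trans ?_
  simp

lemma ee_mul_ee : ee * ee = 0 := DualNumber.eps_mul_eps

lemma fstA_uu_pow (n : ℕ) : fstA (uu ^ n) = Polynomial.X ^ n := by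
  rw [uu_pow]; rfl

lemma sndA_uu_pow (n : ℕ) : sndA (uu ^ n) = 0 := by
  rw [uu_pow]; rfl

lemma fstA_uu_pow_mul_ee (n : ℕ) : fstA (uu ^ n * ee) = 0 := by
  rw [uu_pow_mul_ee]; rfl

lemma sndA_uu_pow_mul_ee (n : ℕ) : sndA (uu ^ n * ee) = Polynomial.X ^ n := by
  rw [uu_pow_mul_ee]; rfl

/-- The element `u^d + c u^(d-k-1) ε` of `A`. -/
def binom (k d c : ℕ) : A := uu ^ d + (c : ℂ) • (uu ^ (d - k - 1) * ee)

lemma binom_eq (k d c : ℕ) : binom k d c = uu ^ d + (c : A) * (uu ^ (d - k - 1) * ee) := by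
  rw [binom, Nat.cast_smul_eq_nsmul, nsmul_eq_mul]

lemma x_eq (k i : ℕ) : x k i = binom k i (i - k) := by
  rw [x, binom_eq]
  split_ifs with h
  · simp [Nat.sub_eq_zero_of_le h]
  · rw [mul_assoc]

lemma x_mul_x (k i j : ℕ) : x k i * x k j = binom k (i + j) ((i - k) + (j - k)) := by
  have key (i j : ℕ) : ((i - k : ℕ) : A) * (uu ^ (i - k - 1) * uu ^ j) =
      ((i - k : ℕ) : A) * uu ^ (i + j - k - 1) := by
    rcases le_or_gt i k with h | h
    · simp [Nat.sub_eq_zero_of_le h]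
    · rw [← pow_add, show i - k - 1 + j = i + j - k - 1 by omega]
  have h₁ := key i j
  have h₂ := key j i
  rw [add_comm j i] at h₂
  simp only [x_eq, binom_eq, Nat.cast_add]
  linear_combination ee * h₁ + ee * h₂ +
    ((i - k : ℕ) : A) * ((j - k : ℕ) : A) * uu ^ (i - k - 1) * uu ^ (j - k - 1) * ee_mul_ee

/-- The `u`-weight of the members of `Bplus k`. -/
def wt (k : ℕ) : Fin (2 * k + 1) ⊕ (Fin (2 * k - 1) ⊕ Fin (2 * k)) → ℕ
  | Sum.inl i => i
  | Sum.inr (Sum.inl i) => k + (i + 1)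
  | Sum.inr (Sum.inr i) => 2 * k + (i + 1)

/-- The `ε`-coefficient of the members of `Bplus k`. -/
def epsCoeff (k : ℕ) : Fin (2 * k + 1) ⊕ (Fin (2 * k - 1) ⊕ Fin (2 * k)) → ℕ
  | Sum.inl i => i - k
  | Sum.inr (Sum.inl i) => i + 1 - k
  | Sum.inr (Sum.inr i) => k + (i + 1 - k)

lemma Bplus_eq (k : ℕ) (a) : Bplus k a = binom k (wt k a) (epsCoeff k a) := by
  rcases a with i | i | i <;> simp only [Bplus, x_mul_x, wt, epsCoeff] <;> congr 1 <;> omega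

/-- The combination of the `u^d`-coefficient and the `u^(d-k-1) ε`-coefficient with
weights `t` and `s`. -/
def coeffComb (k d : ℕ) (s t : ℤ) : A →ₗ[ℂ] ℂ :=
  (s : ℂ) • (Polynomial.lcoeff ℂ (d - k - 1)).comp sndA +
    (t : ℂ) • (Polynomial.lcoeff ℂ d).comp fstA

lemma coeffComb_binom (k d e c : ℕ) (s t : ℤ) (hd : s = 0 ∨ k < d) (hc : c = 0 ∨ k < e) :
    coeffComb k d s t (binom k e c) = ((if e = d then s * c + t else 0 : ℤ) : ℂ) := by
  simp only [coeffComb, binom, LinearMap.add_apply, LinearMap.smul_apply, LinearMap.comp_apply,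
    map_add, map_smul, fstA_uu_pow, sndA_uu_pow, fstA_uu_pow_mul_ee, sndA_uu_pow_mul_ee,
    Polynomial.lcoeff_apply, Polynomial.coeff_X_pow, map_zero,
    smul_eq_mul]
  rcases hd with rfl | hd
  · by_cases h : e = d
    · simp [h]
    · simp [h, Ne.symm h]
  · rcases hc with rfl | hc
    · by_cases h : e = d
      · simp [h]
      · simp [h, Ne.symm h]
    · by_cases h : e = d
      · simp [h, add_comm, mul_comm]
      · have : d - k - 1 ≠ e - k - 1 := by omega
        simp [h, Ne.symm h, this]

lemma epsCoeff_eq_zero_or (k : ℕ) (a) : epsCoeff k a = 0 ∨ k < wt k a := by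
  rcases a with i | i | i <;> simp only [epsCoeff, wt] <;> omega

lemma exists_separating (k : ℕ) (a) : ∃ s t : ℤ, (s = 0 ∨ k < wt k a) ∧
    s * epsCoeff k a + t ≠ 0 ∧
    ∀ b, b ≠ a → wt k b = wt k a → s * epsCoeff k b + t = 0 := by
  rcases a with i | i | i
  · by_cases h : (i : ℕ) ≤ k
    · refine ⟨0, 1, by simp, by simp, ?_⟩
      rintro (j | j | j) hne <;> simp only [wt, ne_eq, Sum.inl.injEq, Fin.ext_iff] at * <;> omega
    · refine ⟨1, 0, ?_, ?_, ?_⟩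
      · simp only [wt]; omega
      · simp only [epsCoeff]; omega
      rintro (j | j | j) hne <;>
        simp only [wt, epsCoeff, ne_eq, Sum.inl.injEq, Fin.ext_iff] at * <;> omega
  · by_cases h : (i : ℕ) + 1 ≤ k
    · refine ⟨1, -((i : ℤ) + 1), ?_, ?_, ?_⟩
      · simp only [wt]; omega
      · simp only [epsCoeff]; omega
      rintro (j | j | j) hne <;>
        simp only [wt, epsCoeff, ne_eq, Sum.inl.injEq, Sum.inr.injEq, Fin.ext_iff] at * <;> omega
    · refine ⟨1, -k, ?_, ?_, ?_⟩
      · simp only [wt]; omega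
      · simp only [epsCoeff]; omega
      rintro (j | j | j) hne <;>
        simp only [wt, epsCoeff, ne_eq, Sum.inl.injEq, Sum.inr.injEq, Fin.ext_iff] at * <;> omega
  · by_cases h : (i : ℕ) + 1 < k
    · refine ⟨1, -((i : ℤ) + 1), ?_, ?_, ?_⟩
      · simp only [wt]; omega
      · simp only [epsCoeff]; omega
      rintro (j | j | j) hne <;>
        simp only [wt, epsCoeff, ne_eq, Sum.inr.injEq, Fin.ext_iff] at * <;> omega
    · refine ⟨0, 1, by simp, by simp, ?_⟩
      rintro (j | j | j) hne <;>
        simp only [wt, ne_eq, Sum.inr.injEq, Fin.ext_iff] at * <;> omega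

lemma linearIndependent_Bplus (k : ℕ) : LinearIndependent ℂ (Bplus k) := by
  rw [Fintype.linearIndependent_iff]
  intro g hg a
  obtain ⟨s, t, hs, hne, hsep⟩ := exists_separating k a
  have h := congrArg (coeffComb k (wt k a) s t) hg
  simp only [map_sum, map_smul, map_zero, Bplus_eq,
    coeffComb_binom _ _ _ _ _ _ hs (epsCoeff_eq_zero_or k _), smul_eq_mul] at h
  rw [Finset.sum_eq_single a] at h
  · rw [if_pos rfl] at h
    exact (mul_eq_zero.mp h).resolve_right (Int.cast_ne_zero.mpr hne)
  · intro b _ hb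
    split_ifs with hw
    · rw [hsep b hb hw]; simp
    · simp
  · simp

lemma binom_mem_of_ne {k d c₁ c₂ : ℕ} {S : Submodule ℂ A} (h₁ : binom k d c₁ ∈ S)
    (h₂ : binom k d c₂ ∈ S) (hne : c₁ ≠ c₂) (c : ℕ) : binom k d c ∈ S := by
  have hc : (c₂ : ℂ) - c₁ ≠ 0 := sub_ne_zero.mpr (by exact_mod_cast hne.symm)
  have : binom k d c = binom k d c₁ +
      (((c : ℂ) - c₁) / ((c₂ : ℂ) - c₁)) • (binom k d c₂ - binom k d c₁) := by
    simp only [binom, add_sub_add_left_eq_sub, ← sub_smul, smul_smul, div_mul_cancel₀ _ hc]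
    module
  rw [this]
  exact S.add_mem h₁ (S.smul_mem _ (S.sub_mem h₂ h₁))

lemma binom_mem_span_Bplus (k : ℕ) (a) :
    binom k (wt k a) (epsCoeff k a) ∈ Submodule.span ℂ (Set.range (Bplus k)) :=
  Bplus_eq k a ▸ Submodule.subset_span ⟨a, rfl⟩

lemma x_mul_x_mem_span (k i j : ℕ) (hi : i ≤ 2 * k) (hj : j ≤ 2 * k) :
    x k i * x k j ∈ Submodule.span ℂ (Set.range (Bplus k)) := by
  rw [x_mul_x]
  have h₀ (d : ℕ) (hd : d ≤ 2 * k) := binom_mem_span_Bplus k (Sum.inl ⟨d, by omega⟩)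
  have h₁ (n : ℕ) (hn : n < 2 * k - 1) := binom_mem_span_Bplus k (Sum.inr (Sum.inl ⟨n, hn⟩))
  have h₂ (n : ℕ) (hn : n < 2 * k) := binom_mem_span_Bplus k (Sum.inr (Sum.inr ⟨n, hn⟩))
  simp only [wt, epsCoeff] at h₀ h₁ h₂
  rcases Nat.lt_or_ge k (i + j) with hk | hk
  · rcases Nat.lt_or_ge (2 * k) (i + j) with hk₂ | hk₂
    · have g₂ := h₂ (i + j - 2 * k - 1) (by omega)
      rw [show 2 * k + (i + j - 2 * k - 1 + 1) = i + j by omega] at g₂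
      rcases Nat.lt_or_ge (i + j) (3 * k) with hk₃ | hk₃
      · have g₁ := h₁ (i + j - k - 1) (by omega)
        rw [show k + (i + j - k - 1 + 1) = i + j by omega] at g₁
        exact binom_mem_of_ne g₁ g₂ (by omega) _
      · convert g₂ using 2
        omega
    · rcases Nat.lt_or_ge (i + j - k - 1) (2 * k - 1) with h | h
      · have g₁ := h₁ (i + j - k - 1) h
        rw [show k + (i + j - k - 1 + 1) = i + j by omega] at g₁
        exact binom_mem_of_ne g₁ (h₀ (i + j) hk₂) (by omega) _
      · omega
  · convert h₀ (i + j) (by omega) using 2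
    omega

lemma x_mul_x_mem_V (k i j : ℕ) (hi : i ≤ 2 * k) (hj : j ≤ 2 * k) :
    x k i * x k j ∈ V k 2 :=
  Submodule.subset_span ⟨![i, j], by simp [Fin.forall_fin_two, hi, hj], by simp⟩

/-- `B⁺` is a basis of `V₂ = H⁰(ω²)`. -/
theorem stmt_4 (k : ℕ) (hk : 2 ≤ k) :
    LinearIndependent ℂ (Bplus k) ∧ Submodule.span ℂ (Set.range (Bplus k)) = V k 2 := by
  refine ⟨linearIndependent_Bplus k, le_antisymm ?_ ?_⟩
  · rw [Submodule.span_le]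
    rintro _ ⟨i | i | i, rfl⟩ <;> exact x_mul_x_mem_V k _ _ (by omega) (by omega)
  · rw [V, Submodule.span_le]
    rintro _ ⟨f, hf, rfl⟩
    rw [Fin.prod_univ_two]
    exact x_mul_x_mem_span k _ _ (hf 0) (hf 1)
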